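/- There exist constants C > 0 and ε₀ > 0 such that for every 0 < ε < ε₀ and every Borel probability measure μ on S with ∫_S ⟨x, e_1⟩ dμ(x) = 0, one has E_{ε,A}(μ) − m_ε ≥ Δ_0 − C·ε·log(1/ε). -/

import Mathlib

open MeasureTheory Real Filter Topology

noncomputable section

/-- The unit sphere `S = 𝕊^{d-1}` in `ℝ^d`. -/
abbrev Sph (d : ℕ) : Type := Metric.sphere (0 : EuclideanSpace ℝ (Fin d)) 1

variable {d : ℕ}

/-- The bilinear form `⟨x, A y⟩` for the diagonal matrix `A = diag lam`. -/
def qA (lam : Fin d → ℝ) (x y : EuclideanSpace ℝ (Fin d)) : ℝ :=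
  ∑ i, lam i * x i * y i

/-- The interaction kernel `K_A(x,y) = exp ⟨x, A y⟩`. -/
def Kker (lam : Fin d → ℝ) (x y : Sph d) : ℝ :=
  Real.exp (qA lam (x : EuclideanSpace ℝ (Fin d)) (y : EuclideanSpace ℝ (Fin d)))

/-- The interaction energy `I_A(μ)`. -/
def IA (lam : Fin d → ℝ) (μ : Measure (Sph d)) : ℝ :=
  ∫ x, ∫ y, Kker lam x y ∂μ ∂μ

/-- The potential `W_μ(x) = ∫ K_A(x,y) dμ(y)`. -/
def WA (lam : Fin d → ℝ) (μ : Measure (Sph d)) (x : Sph d) : ℝ :=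
  ∫ y, Kker lam x y ∂μ

open scoped Classical in
/-- Relative entropy of `μ` with respect to `ω`, with value `+∞` when `μ` is not
absolutely continuous w.r.t. `ω` or the entropy integral diverges. -/
def Ent (ω μ : Measure (Sph d)) : EReal :=
  if μ ≪ ω ∧ Integrable (fun x => Real.log (μ.rnDeriv ω x).toReal) μ
  then ((∫ x, Real.log (μ.rnDeriv ω x).toReal ∂μ : ℝ) : EReal)
  else ⊤

/-- The free energy `E_{ε,A}(μ) = ε·Ent(μ) − (1/2)·I_A(μ)`. -/
def EA (lam : Fin d → ℝ) (ω : Measure (Sph d)) (ε : ℝ) (μ : Measure (Sph d)) : EReal :=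
  (ε : EReal) * Ent ω μ - ((IA lam μ / 2 : ℝ) : EReal)

/-- The antipodal map on the sphere. -/
def antip (x : Sph d) : Sph d :=
  ⟨-(x : EuclideanSpace ℝ (Fin d)), by
    have hx := x.2
    rw [mem_sphere_zero_iff_norm] at hx ⊢
    rwa [norm_neg]⟩

/-- The sphere self-map induced by a linear isometry equivalence of `ℝ^d`. -/
def sphMap (g : EuclideanSpace ℝ (Fin d) ≃ₗᵢ[ℝ] EuclideanSpace ℝ (Fin d)) (x : Sph d) : Sph d :=
  ⟨g (x : EuclideanSpace ℝ (Fin d)), by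
    have hx := x.2
    rw [mem_sphere_zero_iff_norm] at hx ⊢
    rwa [g.norm_map]⟩

/-- `ω` is the uniform probability measure on the sphere, characterised as a
rotation-invariant Borel probability measure. -/
def IsUniform (ω : Measure (Sph d)) : Prop :=
  IsProbabilityMeasure ω ∧
  ∀ g : EuclideanSpace ℝ (Fin d) ≃ₗᵢ[ℝ] EuclideanSpace ℝ (Fin d),
    Measure.map (sphMap g) ω = ω

/-- The (topological) support of a measure. -/
def msupport (μ : Measure (Sph d)) : Set (Sph d) :=
  {x | ∀ U : Set (Sph d), IsOpen U → x ∈ U → 0 < μ U}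

/-- The set of global maximizers of the potential `W_ν`. -/
def argmaxW (lam : Fin d → ℝ) (ν : Measure (Sph d)) : Set (Sph d) :=
  {x | ∀ y, WA lam ν y ≤ WA lam ν x}

/-- `μ` is a Gibbs critical point of `E_{ε,A}`. -/
def IsGibbs (lam : Fin d → ℝ) (ω : Measure (Sph d)) (ε : ℝ) (μ : Measure (Sph d)) : Prop :=
  IsProbabilityMeasure μ ∧
  μ = ω.withDensity (fun x => ENNReal.ofReal
    (Real.exp (WA lam μ x / ε) / ∫ z, Real.exp (WA lam μ z / ε) ∂ω))

/-- `μ` is a global minimizer of `E_{ε,A}` over Borel probability measures. -/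
def IsMinimizer (lam : Fin d → ℝ) (ω : Measure (Sph d)) (ε : ℝ) (μ : Measure (Sph d)) : Prop :=
  IsProbabilityMeasure μ ∧
  ∀ ν : Measure (Sph d), IsProbabilityMeasure ν → EA lam ω ε μ ≤ EA lam ω ε ν

/-- `m_ε`, the infimum of the free energy over probability measures. -/
def mEps (lam : Fin d → ℝ) (ω : Measure (Sph d)) (ε : ℝ) : EReal :=
  sInf {r : EReal | ∃ μ : Measure (Sph d), IsProbabilityMeasure μ ∧ EA lam ω ε μ = r}

lemma sph_sum_sq (x : Sph d) : ∑ i, (x : EuclideanSpace ℝ (Fin d)) i ^ 2 = 1 := by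
  have h := EuclideanSpace.real_norm_sq_eq (x : EuclideanSpace ℝ (Fin d))
  rw [mem_sphere_zero_iff_norm.1 x.2] at h
  rw [← h]; norm_num

lemma sph_erase_sq (x : Sph d) (i0 : Fin d) :
    ∑ i ∈ Finset.univ.erase i0, (x : EuclideanSpace ℝ (Fin d)) i ^ 2
      = 1 - (x : EuclideanSpace ℝ (Fin d)) i0 ^ 2 := by
  have h := sph_sum_sq x
  rw [← Finset.add_sum_erase _ _ (Finset.mem_univ i0)] at h
  linarith

lemma offdiag (lam : Fin d → ℝ) (i0 : Fin d) (L : ℝ) (hpos : ∀ i, 0 < lam i)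
    (hL : ∀ i, i ≠ i0 → lam i ≤ L) (x y : Sph d) :
    |∑ i ∈ Finset.univ.erase i0, lam i * (x : EuclideanSpace ℝ (Fin d)) i *
        (y : EuclideanSpace ℝ (Fin d)) i|
      ≤ L * ((1 - (x : EuclideanSpace ℝ (Fin d)) i0 ^ 2) +
          (1 - (y : EuclideanSpace ℝ (Fin d)) i0 ^ 2)) / 2 := by
  rw [← sph_erase_sq x i0, ← sph_erase_sq y i0, ← Finset.sum_add_distrib, Finset.mul_sum,
    Finset.sum_div]
  refine (Finset.abs_sum_le_sum_abs _ _).trans (Finset.sum_le_sum fun i hi => ?_)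
  have h1 := hL i (Finset.ne_of_mem_erase hi)
  have h0 := hpos i
  set a := (x : EuclideanSpace ℝ (Fin d)) i
  set b := (y : EuclideanSpace ℝ (Fin d)) i
  rw [abs_le]
  constructor <;> nlinarith [mul_nonneg h0.le (sq_nonneg (a - b)),
    mul_nonneg h0.le (sq_nonneg (a + b)),
    mul_nonneg (sub_nonneg.2 h1) (add_nonneg (sq_nonneg a) (sq_nonneg b))]

lemma qA_split (lam : Fin d → ℝ) (i0 : Fin d) (x y : EuclideanSpace ℝ (Fin d)) :
    qA lam x y = lam i0 * x i0 * y i0 +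
      ∑ i ∈ Finset.univ.erase i0, lam i * x i * y i := by
  unfold qA
  rw [← Finset.add_sum_erase _ _ (Finset.mem_univ i0)]

lemma sph_coord_sq_le (x : Sph d) (i0 : Fin d) :
    (x : EuclideanSpace ℝ (Fin d)) i0 ^ 2 ≤ 1 := by
  have h := sph_erase_sq x i0
  have : 0 ≤ ∑ i ∈ Finset.univ.erase i0, (x : EuclideanSpace ℝ (Fin d)) i ^ 2 :=
    Finset.sum_nonneg fun i _ => sq_nonneg _
  linarith

lemma qA_upper (lam : Fin d → ℝ) (i0 : Fin d) (L : ℝ) (hpos : ∀ i, 0 < lam i)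
    (hL : ∀ i, i ≠ i0 → lam i ≤ L) (hL0 : 0 < L) (x y : Sph d) :
    qA lam x y ≤ lam i0 * ((x : EuclideanSpace ℝ (Fin d)) i0 * (y : EuclideanSpace ℝ (Fin d)) i0)
      + L * (1 - |(x : EuclideanSpace ℝ (Fin d)) i0 * (y : EuclideanSpace ℝ (Fin d)) i0|) := by
  rw [qA_split lam i0]
  have h := (abs_le.1 (offdiag lam i0 L hpos hL x y)).2
  set a := (x : EuclideanSpace ℝ (Fin d)) i0
  set b := (y : EuclideanSpace ℝ (Fin d)) i0
  have h2 : |a * b| ≤ (a ^ 2 + b ^ 2) / 2 := by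
    rw [abs_le]; constructor <;> nlinarith [sq_nonneg (a - b), sq_nonneg (a + b)]
  nlinarith

/-- chord bound for the exponential -/
lemma exp_chord (p q r : ℝ) (h0 : 0 ≤ r) (h1 : r ≤ 1) :
    Real.exp ((1 - r) * p + r * q) ≤ (1 - r) * Real.exp p + r * Real.exp q := by
  have := convexOn_exp.2 (Set.mem_univ p) (Set.mem_univ q) (sub_nonneg.2 h1) h0 (by ring)
  simpa using this

lemma scalar_bound (l1 l2 Q r : ℝ) (hQ2 : Real.exp l2 ≤ Q) (hQ1 : Real.cosh l1 ≤ Q)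
    (hr : |r| ≤ 1) :
    Real.exp (l1 * r + l2 * (1 - |r|)) ≤ Q + (Real.exp l1 - Q) * r := by
  have hc : Real.exp l1 + Real.exp (-l1) ≤ 2 * Q := by
    rw [Real.cosh_eq] at hQ1; linarith
  rcases le_total 0 r with h | h
  · rw [abs_of_nonneg h] at hr ⊢
    have := exp_chord l2 l1 r h hr
    rw [show l1 * r + l2 * (1 - r) = (1 - r) * l2 + r * l1 by ring]
    nlinarith
  · rw [abs_of_nonpos h] at hr ⊢
    have := exp_chord l2 (-l1) (-r) (by linarith) hr
    rw [show l1 * r + l2 * (1 - -r) = (1 - -r) * l2 + -r * -l1 by ring]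
    nlinarith

lemma Kker_upper (lam : Fin d → ℝ) (i0 : Fin d) (L Q : ℝ) (hpos : ∀ i, 0 < lam i)
    (hL : ∀ i, i ≠ i0 → lam i ≤ L) (hL0 : 0 < L)
    (hQ2 : Real.exp L ≤ Q) (hQ1 : Real.cosh (lam i0) ≤ Q) (x y : Sph d) :
    Kker lam x y ≤ Q + (Real.exp (lam i0) - Q) *
      ((x : EuclideanSpace ℝ (Fin d)) i0 * (y : EuclideanSpace ℝ (Fin d)) i0) := by
  refine (Real.exp_le_exp.2 (qA_upper lam i0 L hpos hL hL0 x y)).trans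
    (scalar_bound _ _ _ _ hQ2 hQ1 ?_)
  rw [abs_mul]
  exact mul_le_one₀ (abs_le_one_iff_mul_self_le_one.2 (by nlinarith [sph_coord_sq_le x i0]))
    (abs_nonneg _) (abs_le_one_iff_mul_self_le_one.2 (by nlinarith [sph_coord_sq_le y i0]))

lemma coord_cont (i0 : Fin d) :
    Continuous (fun x : Sph d => (x : EuclideanSpace ℝ (Fin d)) i0) := by
  fun_prop

lemma cont_integrable {X : Type*} [TopologicalSpace X] [CompactSpace X] [MeasurableSpace X]
    [OpensMeasurableSpace X] (μ : Measure X) [IsFiniteMeasure μ] (f : X → ℝ)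
    (hf : Continuous f) : Integrable f μ := by
  obtain ⟨C, hC⟩ := (isCompact_range hf).isBounded.exists_norm_le
  exact Integrable.of_bound hf.aestronglyMeasurable C
    (Eventually.of_forall fun x => hC _ ⟨x, rfl⟩)

lemma Kker_cont (lam : Fin d → ℝ) : Continuous (fun p : Sph d × Sph d => Kker lam p.1 p.2) := by
  unfold Kker qA
  fun_prop

lemma IA_upper (lam : Fin d → ℝ) (i0 : Fin d) (L Q : ℝ) (hpos : ∀ i, 0 < lam i)
    (hL : ∀ i, i ≠ i0 → lam i ≤ L) (hL0 : 0 < L)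
    (hQ2 : Real.exp L ≤ Q) (hQ1 : Real.cosh (lam i0) ≤ Q) (μ : Measure (Sph d))
    [IsProbabilityMeasure μ]
    (hμ : ∫ x : Sph d, (x : EuclideanSpace ℝ (Fin d)) i0 ∂μ = 0) : IA lam μ ≤ Q := by
  have hin : ∀ x : Sph d, ∫ y, Kker lam x y ∂μ ≤ Q := by
    intro x
    have h : ∫ y, Kker lam x y ∂μ ≤ ∫ y : Sph d, (Q + ((Real.exp (lam i0) - Q) *
        (x : EuclideanSpace ℝ (Fin d)) i0) * (y : EuclideanSpace ℝ (Fin d)) i0) ∂μ := by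
      refine integral_mono_of_nonneg (Eventually.of_forall fun y => (Real.exp_pos _).le) ?_
        (Eventually.of_forall fun y => ?_)
      · exact cont_integrable _ _ (by fun_prop)
      · have := Kker_upper lam i0 L Q hpos hL hL0 hQ2 hQ1 x y
        simp only
        linarith
    rw [integral_add (integrable_const _) (cont_integrable _ _ (by fun_prop)),
      integral_const_mul, hμ] at h
    simpa using h
  have : IA lam μ ≤ ∫ x : Sph d, Q ∂μ := by
    refine integral_mono_of_nonneg (Eventually.of_forall fun y =>
      integral_nonneg fun z => (Real.exp_pos _).le) (integrable_const _)
      (Eventually.of_forall hin)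
  simpa using this

lemma Ent_nonneg (ω μ : Measure (Sph d)) [IsProbabilityMeasure ω] [IsProbabilityMeasure μ] :
    0 ≤ Ent ω μ := by
  unfold Ent
  split_ifs with h
  · have := InformationTheory.integral_llr_add_sub_measure_univ_nonneg (μ := μ) (ν := ω) h.1 h.2
    simp [llr] at this
    exact_mod_cast this
  · exact le_top

lemma EA_lower (lam : Fin d → ℝ) (ω μ : Measure (Sph d)) [IsProbabilityMeasure ω]
    [IsProbabilityMeasure μ] (ε Q : ℝ) (hε : 0 < ε) (hQ : IA lam μ ≤ Q) :
    ((-(Q / 2) : ℝ) : EReal) ≤ EA lam ω ε μ := by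
  unfold EA
  have h : (0 : EReal) ≤ (ε : EReal) * Ent ω μ :=
    mul_nonneg (by exact_mod_cast hε.le) (Ent_nonneg ω μ)
  have h2 : ((IA lam μ / 2 : ℝ) : EReal) ≤ ((Q / 2 : ℝ) : EReal) := by
    exact_mod_cast (by linarith)
  calc ((-(Q / 2) : ℝ) : EReal) = 0 - ((Q / 2 : ℝ) : EReal) := by simp
    _ ≤ _ := EReal.sub_le_sub h h2

/-- the polar cap -/
def capS (i0 : Fin d) (η : ℝ) : Set (Sph d) :=
  {x | 1 - η ≤ (x : EuclideanSpace ℝ (Fin d)) i0}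

lemma capS_meas (i0 : Fin d) (η : ℝ) : MeasurableSet (capS i0 η) :=
  (isClosed_le continuous_const (coord_cont i0)).measurableSet

lemma Kker_lower (lam : Fin d → ℝ) (i0 : Fin d) (hpos : ∀ i, 0 < lam i)
    (hL : ∀ i, i ≠ i0 → lam i ≤ lam i0) (η : ℝ) (hη : 0 ≤ η) (x y : Sph d)
    (hx : x ∈ capS i0 η) (hy : y ∈ capS i0 η) :
    Real.exp (lam i0) - Real.exp (lam i0) * (4 * lam i0 * η) ≤ Kker lam x y := by
  have hq : lam i0 - 4 * lam i0 * η ≤ qA lam x y := by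
    rw [qA_split lam i0]
    have h := (abs_le.1 (offdiag lam i0 (lam i0) hpos hL x y)).1
    have hx1 := sph_coord_sq_le x i0
    have hy1 := sph_coord_sq_le y i0
    have h0 := hpos i0
    simp only [capS, Set.mem_ofPred_eq] at hx hy
    set a := (x : EuclideanSpace ℝ (Fin d)) i0
    set b := (y : EuclideanSpace ℝ (Fin d)) i0
    have ha : a ≤ 1 := by nlinarith
    have hb : b ≤ 1 := by nlinarith
    have k1 : 1 - 2 * η ≤ a * b := by nlinarith [mul_nonneg (sub_nonneg.2 ha) (sub_nonneg.2 hb)]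
    have k2 : 1 - 2 * η ≤ a ^ 2 := by nlinarith [sq_nonneg (a - 1)]
    have k3 : 1 - 2 * η ≤ b ^ 2 := by nlinarith [sq_nonneg (b - 1)]
    nlinarith [mul_le_mul_of_nonneg_left k1 h0.le, mul_le_mul_of_nonneg_left k2 h0.le,
      mul_le_mul_of_nonneg_left k3 h0.le]
  unfold Kker
  refine le_trans ?_ (Real.exp_le_exp.2 hq)
  rw [sub_eq_add_neg (lam i0), Real.exp_add]
  nlinarith [Real.add_one_le_exp (-(4 * lam i0 * η)), Real.exp_pos (lam i0)]

lemma capS_rot (ω : Measure (Sph d)) (hω : IsUniform ω) (i0 : Fin d) (η : ℝ) (z : Sph d) :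
    ω {x : Sph d | 1 - η ≤ inner ℝ (x : EuclideanSpace ℝ (Fin d)) z} = ω (capS i0 η) := by
  have hn : ‖(z : EuclideanSpace ℝ (Fin d))‖ = ‖EuclideanSpace.single i0 (1 : ℝ)‖ := by
    rw [mem_sphere_zero_iff_norm.1 z.2]; simp
  set g := (Submodule.span ℝ {(z : EuclideanSpace ℝ (Fin d)) -
    EuclideanSpace.single i0 (1 : ℝ)})ᗮ.reflection with hg
  have hgz : g z = EuclideanSpace.single i0 (1 : ℝ) := Submodule.reflection_sub hn
  have hm : Measurable (sphMap g) := by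
    apply Continuous.measurable
    unfold sphMap
    exact Continuous.subtype_mk (g.continuous.comp continuous_subtype_val) _
  conv_rhs => rw [← hω.2 g, Measure.map_apply hm (capS_meas i0 η)]
  congr 1
  ext x
  simp only [capS, Set.mem_ofPred_eq, Set.mem_preimage, sphMap]
  have : inner ℝ (x : EuclideanSpace ℝ (Fin d)) z = (g x) i0 := by
    rw [← g.inner_map_map, hgz, EuclideanSpace.inner_single_right]
    simp
  rw [this]

lemma inner_of_close (x z : Sph d) (k : ℝ) (hk : 0 < k)
    (h : ∀ i, |(x : EuclideanSpace ℝ (Fin d)) i * k - (z : EuclideanSpace ℝ (Fin d)) i * k| ≤ 1) :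
    1 - (d : ℝ) / k ^ 2 ≤ inner ℝ (x : EuclideanSpace ℝ (Fin d)) z := by
  have h1 : ∑ i, ((x : EuclideanSpace ℝ (Fin d)) i - (z : EuclideanSpace ℝ (Fin d)) i) ^ 2
      ≤ ∑ i : Fin d, 1 / k ^ 2 := by
    refine Finset.sum_le_sum fun i _ => ?_
    rw [le_div_iff₀ (by positivity), ← mul_pow, ← sq_abs, sub_mul]
    exact pow_le_one₀ (abs_nonneg _) (h i)
  have h2 : ∑ i, ((x : EuclideanSpace ℝ (Fin d)) i - (z : EuclideanSpace ℝ (Fin d)) i) ^ 2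
      = ∑ i, (x : EuclideanSpace ℝ (Fin d)) i ^ 2 + ∑ i, (z : EuclideanSpace ℝ (Fin d)) i ^ 2
        - 2 * inner ℝ (x : EuclideanSpace ℝ (Fin d)) z := by
    rw [PiLp.inner_apply, Finset.mul_sum, ← Finset.sum_add_distrib, ← Finset.sum_sub_distrib]
    refine Finset.sum_congr rfl fun i _ => ?_
    simp
    ring
  rw [h2, sph_sum_sq, sph_sum_sq] at h1
  simp at h1
  have : 0 ≤ (d : ℝ) / k ^ 2 := by positivity
  rw [← div_eq_mul_inv] at h1
  linarith

lemma cap_mass (ω : Measure (Sph d)) (hω : IsUniform ω) (i0 : Fin d) (k : ℕ) (hk : 0 < k) :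
    1 ≤ ((2 * k + 1 : ℕ) ^ d : ℝ) * (ω (capS i0 ((d : ℝ) / (k : ℝ) ^ 2))).toReal := by
  haveI := hω.1
  set η := (d : ℝ) / (k : ℝ) ^ 2 with hη
  let F : Finset (Fin d → ℤ) := Fintype.piFinset fun _ => Finset.Icc (-(k : ℤ)) k
  let cell : (Fin d → ℤ) → Set (Sph d) := fun n =>
    {x | ∀ i, ⌊(x : EuclideanSpace ℝ (Fin d)) i * k⌋ = n i}
  have hkR : (0 : ℝ) < k := by exact_mod_cast hk
  have hcov : (Set.univ : Set (Sph d)) ⊆ ⋃ n ∈ F, cell n := by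
    intro x _
    simp only [Set.mem_iUnion]
    refine ⟨fun i => ⌊(x : EuclideanSpace ℝ (Fin d)) i * k⌋, ?_, fun i => rfl⟩
    simp only [F, Fintype.mem_piFinset, Finset.mem_Icc]
    intro i
    have h := sph_coord_sq_le x i
    have hb := abs_le.1 (abs_le_one_iff_mul_self_le_one.2
      (by nlinarith : (x : EuclideanSpace ℝ (Fin d)) i * (x : EuclideanSpace ℝ (Fin d)) i ≤ 1))
    constructor
    · rw [Int.le_floor]; push_cast; nlinarith
    · have : (⌊(x : EuclideanSpace ℝ (Fin d)) i * k⌋ : ℝ) ≤ k :=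
        (Int.floor_le _).trans (by nlinarith)
      exact_mod_cast this
  have hcell : ∀ n, ω (cell n) ≤ ω (capS i0 η) := by
    intro n
    rcases (cell n).eq_empty_or_nonempty with h | ⟨z, hz⟩
    · simp [h]
    · rw [← capS_rot ω hω i0 η z]
      refine measure_mono fun x hx => ?_
      refine inner_of_close x z k hkR fun i => ?_
      exact (Int.abs_sub_lt_one_of_floor_eq_floor ((hx i).trans (hz i).symm)).le
  have h1 : (1 : ENNReal) ≤ ∑ n ∈ F, ω (capS i0 η) := by
    calc (1 : ENNReal) = ω Set.univ := measure_univ.symm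
      _ ≤ ω (⋃ n ∈ F, cell n) := measure_mono hcov
      _ ≤ ∑ n ∈ F, ω (cell n) := measure_biUnion_finset_le _ _
      _ ≤ _ := Finset.sum_le_sum fun n _ => hcell n
  have hF : F.card = (2 * k + 1) ^ d := by
    simp only [F, Fintype.card_piFinset, Int.card_Icc, Finset.prod_const, Finset.card_univ,
      Fintype.card_fin]
    congr 1
    omega
  rw [Finset.sum_const, hF, nsmul_eq_mul] at h1
  have h2 := ENNReal.toReal_mono (ENNReal.mul_ne_top (ENNReal.natCast_ne_top _)
    (measure_ne_top _ _)) h1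
  rw [ENNReal.toReal_mul, ENNReal.toReal_natCast] at h2
  simpa using h2

/-- energy of the trial measure -/
lemma trial (lam : Fin d → ℝ) (ω : Measure (Sph d)) [IsProbabilityMeasure ω] (B : Set (Sph d))
    (hB : MeasurableSet B) (hB0 : 0 < (ω B).toReal) (ε b : ℝ)
    (hK : ∀ x ∈ B, ∀ y ∈ B, b ≤ Kker lam x y) (hε : 0 < ε) :
    mEps lam ω ε ≤ ((ε * Real.log (ω B).toReal⁻¹ - b / 2 : ℝ) : EReal) := by
  have hB1 : ω B ≠ 0 := fun h => by simp [h] at hB0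
  set c : ENNReal := (ω B)⁻¹ with hc
  have hcR : c.toReal = (ω B).toReal⁻¹ := ENNReal.toReal_inv _
  let ν : Measure (Sph d) := ω.withDensity (B.indicator fun _ => c)
  have hνd : ν = c • ω.restrict B := by
    simp only [ν]
    rw [withDensity_indicator hB, withDensity_const]
  haveI hν : IsProbabilityMeasure ν := ⟨by
    rw [hνd]; simp [hc, ENNReal.inv_mul_cancel hB1 (measure_ne_top _ _)]⟩
  have hac : ν ≪ ω := withDensity_absolutelyContinuous _ _
  have hmem : ∀ᵐ x ∂ν, x ∈ B := by
    rw [hνd]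
    exact Measure.ae_smul_measure (ae_restrict_mem hB) c
  have hrn : ∀ᵐ x ∂ν, ν.rnDeriv ω x = B.indicator (fun _ => c) x :=
    hac.ae_le (Measure.rnDeriv_withDensity ω (measurable_const.indicator hB))
  have hlog : (fun x => Real.log (ν.rnDeriv ω x).toReal) =ᵐ[ν]
      fun _ => Real.log (ω B).toReal⁻¹ := by
    filter_upwards [hmem, hrn] with x h1 h2
    rw [h2, Set.indicator_of_mem h1, hcR]
  have hEnt : Ent ω ν = ((Real.log (ω B).toReal⁻¹ : ℝ) : EReal) := by
    unfold Ent
    rw [if_pos ⟨hac, (integrable_const _).congr hlog.symm⟩, integral_congr_ae hlog]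
    simp
  have hI : b ≤ IA lam ν := by
    have hint : Integrable (fun p : Sph d × Sph d => Kker lam p.1 p.2) (ν.prod ν) :=
      cont_integrable _ _ (Kker_cont lam)
    have hin : ∀ x ∈ B, b ≤ ∫ y, Kker lam x y ∂ν := by
      intro x hx
      have : ∫ y, b ∂ν ≤ ∫ y, Kker lam x y ∂ν := by
        refine integral_mono_ae (integrable_const _) (cont_integrable _ _
          ((Kker_cont lam).comp (by fun_prop : Continuous fun y => (x, y)))) ?_
        filter_upwards [hmem] with y hy using hK x hx y hy
      simpa using this
    have : ∫ x, b ∂ν ≤ IA lam ν := by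
      refine integral_mono_ae (integrable_const _) hint.integral_prod_left ?_
      filter_upwards [hmem] with y hy using hin y hy
    simpa using this
  have hle : mEps lam ω ε ≤ EA lam ω ε ν := sInf_le ⟨ν, hν, rfl⟩
  refine hle.trans ?_
  unfold EA
  rw [hEnt]
  rw [← EReal.coe_mul, ← EReal.coe_sub, EReal.coe_le_coe_iff]
  linarith

lemma mEps_upper (lam : Fin d → ℝ) (i0 : Fin d) (hpos : ∀ i, 0 < lam i)
    (hL : ∀ i, i ≠ i0 → lam i ≤ lam i0) (ω : Measure (Sph d)) (hω : IsUniform ω)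
    (ε : ℝ) (hε : 0 < ε) (hε1 : ε < 1 / 5) :
    mEps lam ω ε ≤ ((-(Real.exp (lam i0) / 2) +
      (2 * d + 2 * d * lam i0 * Real.exp (lam i0)) * ε * Real.log (1 / ε) : ℝ) : EReal) := by
  haveI := hω.1
  set k := ⌈1 / ε⌉₊ with hk
  have hinv : 5 < 1 / ε := by rw [lt_div_iff₀ hε]; linarith
  have hk1 : 1 / ε ≤ k := Nat.le_ceil _
  have hk2 : (k : ℝ) < 1 / ε + 1 := Nat.ceil_lt_add_one (by positivity)
  have hkpos : 0 < k := Nat.ceil_pos.2 (by positivity)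
  have hlog1 : 1 ≤ Real.log (1 / ε) := by
    rw [Real.le_log_iff_exp_le (by positivity)]
    linarith [Real.exp_one_lt_d9]
  set η := (d : ℝ) / (k : ℝ) ^ 2 with hη
  have hη0 : 0 ≤ η := by positivity
  have hηε : η ≤ d * ε := by
    have : (1 / ε) ≤ (k : ℝ) ^ 2 := by nlinarith
    rw [hη, div_le_iff₀ (by positivity)]
    have h3 : 1 ≤ ε * (k : ℝ) ^ 2 := by
      rw [div_le_iff₀ hε] at this; linarith
    have hd : (0 : ℝ) ≤ d := Nat.cast_nonneg _
    nlinarith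
  have hm := cap_mass ω hω i0 k hkpos
  have hB0 : 0 < (ω (capS i0 η)).toReal := by
    rcases ENNReal.toReal_nonneg.eq_or_lt (b := (ω (capS i0 η)).toReal) with h | h
    · rw [← hη, ← h] at hm; norm_num at hm
    · exact h
  refine (trial lam ω _ (capS_meas i0 η) hB0 ε _
    (fun x hx y hy => Kker_lower lam i0 hpos hL η hη0 x y hx hy) hε).trans ?_
  have hlogB : Real.log (ω (capS i0 η)).toReal⁻¹ ≤ 2 * d * Real.log (1 / ε) := by
    have h1 : (ω (capS i0 η)).toReal⁻¹ ≤ ((2 * k + 1 : ℕ) ^ d : ℝ) := by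
      rw [inv_le_iff_one_le_mul₀ hB0]; exact hm
    have h2 : (((2 * k + 1 : ℕ) : ℝ)) ≤ (1 / ε) ^ 2 := by
      push_cast; nlinarith
    calc _ ≤ Real.log ((((1 / ε) ^ 2) ^ d : ℝ)) := by
          refine Real.log_le_log (by positivity) (h1.trans ?_)
          gcongr
      _ = _ := by rw [Real.log_pow, Real.log_pow]; push_cast; ring
  have hl : 0 < lam i0 * Real.exp (lam i0) := mul_pos (hpos i0) (Real.exp_pos _)
  have e1 : ε * Real.log (ω (capS i0 η)).toReal⁻¹ ≤ ε * (2 * d * Real.log (1 / ε)) :=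
    mul_le_mul_of_nonneg_left hlogB hε.le
  have e2 : lam i0 * Real.exp (lam i0) * η ≤ lam i0 * Real.exp (lam i0) * (d * ε * Real.log (1 / ε)) := by
    refine mul_le_mul_of_nonneg_left (hηε.trans ?_) hl.le
    exact le_mul_of_one_le_right (by positivity) hlog1
  rw [EReal.coe_le_coe_iff]
  nlinarith [e1, e2]

/-- finite-temperature sign-changing barrier. -/
theorem stmt8 (d : ℕ) (hd : 2 ≤ d) (lam : Fin d → ℝ)
    (hanti : Antitone lam)
    (hgap : lam ⟨1, by omega⟩ < lam ⟨0, by omega⟩)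
    (hpos : ∀ i, 0 < lam i)
    (ω : Measure (Sph d)) (hω : IsUniform ω) :
    ∃ C : ℝ, 0 < C ∧ ∃ ε₀ : ℝ, 0 < ε₀ ∧ ∀ ε : ℝ, 0 < ε → ε < ε₀ →
      ∀ μ : Measure (Sph d), IsProbabilityMeasure μ →
        (∫ x : Sph d, (x : EuclideanSpace ℝ (Fin d)) ⟨0, by omega⟩ ∂μ) = 0 →
        (((Real.exp (lam ⟨0, by omega⟩) - (max (Real.exp (lam ⟨1, by omega⟩)) (Real.cosh (lam ⟨0, by omega⟩)))) / 2 - C * ε * Real.log (1 / ε) : ℝ) : EReal) ≤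
          EA lam ω ε μ - mEps lam ω ε := by
  haveI := hω.1
  set i0 : Fin d := ⟨0, by omega⟩ with hi0
  set i1 : Fin d := ⟨1, by omega⟩ with hi1
  have hL1 : ∀ i, i ≠ i0 → lam i ≤ lam i1 := by
    intro i hi
    apply hanti
    rw [Fin.le_def]
    have : i.val ≠ 0 := fun h => hi (Fin.ext h)
    simp only [hi1]
    omega
  have hL0 : ∀ i, i ≠ i0 → lam i ≤ lam i0 := fun i hi => (hL1 i hi).trans hgap.le
  have hd0 : (0 : ℝ) < d := by exact_mod_cast (by omega : 0 < d)
  have hp := hpos i0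
  refine ⟨2 * d + 2 * d * lam i0 * Real.exp (lam i0), by positivity, 1 / 5, by norm_num, ?_⟩
  intro ε hε hε1 μ hμ hmean
  have h1 := EA_lower lam ω μ ε _ hε (IA_upper lam i0 (lam i1) _ hpos hL1 (hpos i1)
    (le_max_left (Real.exp (lam i1)) (Real.cosh (lam i0))) (le_max_right _ _) μ hmean)
  have h2 := mEps_upper lam i0 hpos hL0 ω hω ε hε hε1
  refine le_trans (le_of_eq ?_) (EReal.sub_le_sub h1 h2)
  rw [← EReal.coe_sub]
  congr 1
  ring

end
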